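/- Let D be an H-colored r-partite tournament (r ≥ 2). If k ≥ 5, then D has a (k,H)-kernel. -/

import Mathlib

/-!
Setting: `A : V → V → Prop` is the arc relation of a loopless digraph `D`,
`AH : VH → VH → Prop` is the arc relation of a digraph `H` (possibly with loops),
and `ρ : V → V → VH` colors each arc of `D` with a vertex of `H`
(`D` is an `H`-colored digraph).
-/

open scoped Classical

noncomputable section

variable {V VH : Type*}

/-- `x 0, x 1, …, x n` is a walk of length `n` in the digraph with arc relation `A`. -/
def IsWalk (A : V → V → Prop) (n : ℕ) (x : ℕ → V) : Prop :=
  ∀ i < n, A (x i) (x (i + 1))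

/-- A (directed) path of length `n`: a walk whose `n + 1` vertices are pairwise distinct. -/
def IsPath (A : V → V → Prop) (n : ℕ) (x : ℕ → V) : Prop :=
  IsWalk A n x ∧ ∀ i ≤ n, ∀ j ≤ n, x i = x j → i = j

/-- A (directed) cycle of length `n`: a nontrivial closed walk whose first `n` vertices are
pairwise distinct. -/
def IsCycle (A : V → V → Prop) (n : ℕ) (x : ℕ → V) : Prop :=
  IsWalk A n x ∧ x n = x 0 ∧ 1 ≤ n ∧ ∀ i < n, ∀ j < n, x i = x j → i = j

/-- The set `O_H(W)` of obstructions of an open walk `W = (x 0, …, x n)`: the indices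
`i ∈ {1, …, n-1}` such that `(ρ(x_{i-1}, x_i), ρ(x_i, x_{i+1}))` is not an arc of `H`. -/
def obstrOpen (AH : VH → VH → Prop) (ρ : V → V → VH) (n : ℕ) (x : ℕ → V) : Finset ℕ :=
  (Finset.Ico 1 n).filter fun i => ¬ AH (ρ (x (i - 1)) (x i)) (ρ (x i) (x (i + 1)))

/-- The set `O_H(W)` of obstructions of a closed walk `W = (x 0, …, x n)` (`x n = x 0`):
the indices `i ∈ {0, …, n-1}`, taken modulo `n`, such that
`(ρ(x_{i-1}, x_i), ρ(x_i, x_{i+1}))` is not an arc of `H`. -/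
def obstrClosed (AH : VH → VH → Prop) (ρ : V → V → VH) (n : ℕ) (x : ℕ → V) : Finset ℕ :=
  (Finset.range n).filter fun i =>
    ¬ AH (ρ (x (if i = 0 then n - 1 else i - 1)) (x i)) (ρ (x i) (x (i + 1)))

/-- The `H`-length of an open walk: `|O_H(W)| + 1`. -/
def HLenOpen (AH : VH → VH → Prop) (ρ : V → V → VH) (n : ℕ) (x : ℕ → V) : ℕ :=
  (obstrOpen AH ρ n x).card + 1

/-- The `H`-length of a closed walk: `|O_H(W)|`. -/
def HLenClosed (AH : VH → VH → Prop) (ρ : V → V → VH) (n : ℕ) (x : ℕ → V) : ℕ :=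
  (obstrClosed AH ρ n x).card

/-- `(u,v)` is an arc of the `(l,H)`-closure `C_H^l(D)` iff there exists a `uv`-path in `D`
with `H`-length at most `l`. -/
def ClosureAdj (A : V → V → Prop) (AH : VH → VH → Prop) (ρ : V → V → VH) (l : ℕ)
    (u v : V) : Prop :=
  ∃ n x, 1 ≤ n ∧ IsPath A n x ∧ x 0 = u ∧ x n = v ∧ HLenOpen AH ρ n x ≤ l

/-- `S` is `(k,H)`-independent: every path between two different vertices of `S`
has `H`-length at least `k`. -/
def KHIndependent (A : V → V → Prop) (AH : VH → VH → Prop) (ρ : V → V → VH)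
    (k : ℕ) (S : Set V) : Prop :=
  ∀ u ∈ S, ∀ v ∈ S, u ≠ v →
    ∀ n x, IsPath A n x → x 0 = u → x n = v → k ≤ HLenOpen AH ρ n x

/-- `S` is `(l,H)`-absorbent: from every vertex outside `S` there exists a path to some
vertex of `S` with `H`-length at most `l`. -/
def LHAbsorbent (A : V → V → Prop) (AH : VH → VH → Prop) (ρ : V → V → VH)
    (l : ℕ) (S : Set V) : Prop :=
  ∀ v ∉ S, ∃ w ∈ S, ∃ n x, IsPath A n x ∧ x 0 = v ∧ x n = w ∧ HLenOpen AH ρ n x ≤ l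

/-- A `(k,H)`-kernel: a `(k,H)`-independent and `(k-1,H)`-absorbent set of vertices. -/
def IsKHKernel (A : V → V → Prop) (AH : VH → VH → Prop) (ρ : V → V → VH)
    (k : ℕ) (S : Set V) : Prop :=
  KHIndependent A AH ρ k S ∧ LHAbsorbent A AH ρ (k - 1) S

/-- A kernel of a digraph: an independent and absorbent set of vertices. -/
def IsKernel (A : V → V → Prop) (S : Set V) : Prop :=
  (∀ u ∈ S, ∀ v ∈ S, u ≠ v → ¬ A u v) ∧ ∀ u ∉ S, ∃ v ∈ S, A u v

/-- An `r`-partite tournament: the vertices are partitioned into `r` independent classes and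
any two vertices in different classes are joined by exactly one arc. -/
def RPartiteTournament (A : V → V → Prop) (r : ℕ) : Prop :=
  ∃ f : V → Fin r, Function.Surjective f ∧
    (∀ u v : V, f u = f v → ¬ A u v) ∧
    (∀ u v : V, f u ≠ f v → (A u v ↔ ¬ A v u))

/-- A finite digraph whose asymmetric arcs strictly decrease a potential has a kernel. -/
theorem exists_isKernel_of_potential [Fintype V] (C : V → V → Prop) (g : V → ℕ)
    (hg : ∀ u v, C u v → ¬ C v u → g v < g u) : ∃ S : Set V, IsKernel C S := by
  suffices h : ∀ T : Finset V, ∃ S ⊆ (T : Set V),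
      (∀ u ∈ S, ∀ v ∈ S, u ≠ v → ¬ C u v) ∧ ∀ u ∈ T, u ∉ S → ∃ v ∈ S, C u v by
    obtain ⟨S, -, hind, habs⟩ := h Finset.univ
    exact ⟨S, hind, fun u hu => habs u (Finset.mem_univ u) hu⟩
  intro T
  induction T using Finset.strongInduction with
  | H T ih =>
    rcases T.eq_empty_or_nonempty with rfl | hT
    · exact ⟨∅, by simp⟩
    obtain ⟨v, hvT, hmin⟩ := T.exists_min_image g hT
    have hsink : ∀ w ∈ T, C v w → C w v := fun w hw hvw => by
      by_contra hwv
      exact absurd (hg v w hvw hwv) (not_lt.mpr (hmin w hw))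
    obtain ⟨S, hST, hind, habs⟩ := ih (T.filter fun w => w ≠ v ∧ ¬ C w v)
      (Finset.filter_ssubset.mpr ⟨v, hvT, by simp⟩)
    have hS : ∀ w ∈ S, w ∈ T ∧ w ≠ v ∧ ¬ C w v := fun w hw => by simpa using hST hw
    refine ⟨insert v S, ?_, ?_, ?_⟩
    · rintro w (rfl | hw)
      exacts [hvT, (hS w hw).1]
    · rintro a (rfl | ha) b (rfl | hb) hab
      · exact absurd rfl hab
      · exact fun h => (hS b hb).2.2 (hsink b (hS b hb).1 h)
      · exact (hS a ha).2.2
      · exact hind a ha b hb hab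
    · intro w hw hwS
      rw [Set.mem_insert_iff, not_or] at hwS
      by_cases hwv : C w v
      · exact ⟨v, Set.mem_insert _ _, hwv⟩
      · obtain ⟨z, hz, hwz⟩ := habs w (Finset.mem_filter.mpr ⟨hw, hwS.1, hwv⟩) hwS.2
        exact ⟨z, Set.mem_insert_of_mem _ hz, hwz⟩

/-- `v` can be reached from `u` by a walk of length at most `n`. -/
def ReachLE (A : V → V → Prop) : ℕ → V → V → Prop
  | 0, u, v => u = v
  | n + 1, u, v => u = v ∨ ∃ w, ReachLE A n u w ∧ A w v

theorem ReachLE.refl (A : V → V → Prop) (n : ℕ) (u : V) : ReachLE A n u u := by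
  cases n with
  | zero => rfl
  | succ n => exact Or.inl rfl

theorem ReachLE.step {A : V → V → Prop} {n : ℕ} {u v w : V} (h : ReachLE A n u v)
    (hvw : A v w) : ReachLE A (n + 1) u w :=
  Or.inr ⟨v, h, hvw⟩

theorem ReachLE.mono {A : V → V → Prop} {m n : ℕ} (hmn : m ≤ n) {u v : V}
    (h : ReachLE A m u v) : ReachLE A n u v := by
  induction m generalizing n v with
  | zero => exact h ▸ ReachLE.refl A n u
  | succ m ih =>
    obtain ⟨n, rfl⟩ := Nat.exists_eq_succ_of_ne_zero (by omega : n ≠ 0)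
    rcases h with rfl | ⟨w, hw, hwv⟩
    · exact ReachLE.refl A _ u
    · exact (ih (by omega) hw).step hwv

theorem ReachLE.of_arc {A : V → V → Prop} {u v : V} (h : A u v) : ReachLE A 1 u v :=
  (ReachLE.refl A 0 u).step h

theorem ReachLE.exists_isPath {A : V → V → Prop} {n : ℕ} {u v : V} (h : ReachLE A n u v) :
    ∃ m ≤ n, ∃ x, IsPath A m x ∧ x 0 = u ∧ x m = v := by
  have trivial_path : ∀ u : V, IsPath A 0 fun _ => u := fun u =>
    ⟨fun i hi => absurd hi (Nat.not_lt_zero i), fun i hi j hj _ => by omega⟩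
  induction n generalizing v with
  | zero => exact ⟨0, le_rfl, fun _ => u, trivial_path u, rfl, h⟩
  | succ n ih =>
    rcases h with rfl | ⟨w, hw, hwv⟩
    · exact ⟨0, Nat.zero_le _, fun _ => u, trivial_path u, rfl, rfl⟩
    obtain ⟨m, hm, x, ⟨hwalk, hinj⟩, hx0, hxm⟩ := ih hw
    by_cases hv : ∃ i ≤ m, x i = v
    · obtain ⟨i, hi, hxi⟩ := hv
      exact ⟨i, by omega, x, ⟨fun j hj => hwalk j (by omega),
        fun a ha b hb => hinj a (by omega) b (by omega)⟩, hx0, hxi⟩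
    push Not at hv
    refine ⟨m + 1, by omega, fun i => if i ≤ m then x i else v, ⟨?_, ?_⟩, by simpa using hx0,
      by simp⟩
    · intro i hi
      rcases Nat.lt_succ_iff_lt_or_eq.mp hi with hi | rfl
      · simpa [hi.le, Nat.succ_le_of_lt hi] using hwalk i hi
      · simpa [hxm] using hwv
    · intro i hi j hj hij
      by_cases him : i ≤ m <;> by_cases hjm : j ≤ m <;>
        simp only [him, hjm, if_true, if_false] at hij
      · exact hinj i him j hjm hij
      · exact absurd hij (hv i him)
      · exact absurd hij.symm (hv j hjm)
      · omega

theorem HLenOpen_le {AH : VH → VH → Prop} {ρ : V → V → VH} {m n : ℕ} {x : ℕ → V} (hn : 1 ≤ n)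
    (hmn : m ≤ n) : HLenOpen AH ρ m x ≤ n := by
  have h : (obstrOpen AH ρ m x).card ≤ (Finset.Ico 1 m).card := Finset.card_filter_le _ _
  rw [Nat.card_Ico] at h
  unfold HLenOpen
  omega

section Multipartite

variable {A : V → V → Prop} {ι : Type*} {f : V → ι}

/-- In a multipartite tournament, if a walk leads from `u` to `v` and `v` does not reach `u` in
four steps, then `u` reaches `v` in two steps. -/
theorem reachLE_two_of_walk (hf : ∀ u v : V, f u = f v → ¬ A u v)
    (hA : ∀ u v : V, f u ≠ f v → (A u v ↔ ¬ A v u)) {u v : V} (h4 : ¬ ReachLE A 4 v u)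
    {n : ℕ} {x : ℕ → V} (hx : IsWalk A n x) (hx0 : x 0 = u) (hxn : x n = v) :
    ReachLE A 2 u v := by
  have arc : ∀ {a b}, f a ≠ f b → ¬ A a b → A b a := fun {a b} hab h => by
    by_contra h'
    exact h ((hA a b hab).2 h')
  by_cases huv : f v = f u
  · by_contra h2
    have out : ∀ {w}, f w ≠ f u → A u w → A v w := fun {w} hw huw =>
      arc (huv ▸ hw) fun hwv => h2 ((ReachLE.of_arc huw).step hwv)
    have back : ∀ {w}, f w ≠ f u → ReachLE A 3 v w → A u w := fun {w} hw hvw =>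
      arc hw fun hwu => h4 (hvw.step hwu)
    have hreach : ∀ i ≤ n, x i = u ∨ ReachLE A 2 v (x i) := by
      intro i
      induction i with
      | zero => exact fun _ => Or.inl hx0
      | succ i ih =>
        intro hi
        have harc := hx i (by omega)
        have hne : f (x i) ≠ f (x (i + 1)) := fun h => hf _ _ h harc
        rcases ih (by omega) with h | h
        · rw [h] at harc hne
          exact Or.inr ((ReachLE.of_arc (out hne.symm harc)).mono (by omega))
        · right
          by_cases hc : f (x (i + 1)) = f u
          · have hc' : f (x i) ≠ f u := hc ▸ hne
            exact (ReachLE.of_arc (out hc' (back hc' (h.mono (by omega))))).step harc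
          · exact (ReachLE.of_arc (out hc (back hc (h.step harc)))).mono (by omega)
    obtain ⟨n, rfl⟩ : ∃ m, n = m + 1 := by
      refine Nat.exists_eq_succ_of_ne_zero fun hn => h4 ?_
      subst hn
      rw [← hx0, hxn]
      exact ReachLE.refl A 4 v
    have harc := hx n (by omega)
    rw [hxn] at harc
    have hne : f (x n) ≠ f u := fun h => hf _ _ (h.trans huv.symm) harc
    rcases hreach n (by omega) with h | h
    · exact hne (congrArg f h)
    · exact h2 ((ReachLE.of_arc (back hne (h.mono (by omega)))).step harc)
  · exact (ReachLE.of_arc (arc huv fun h => h4 ((ReachLE.of_arc h).mono (by omega)))).mono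
      (by omega)

theorem reachLE_two_subset (hf : ∀ u v : V, f u = f v → ¬ A u v)
    (hA : ∀ u v : V, f u ≠ f v → (A u v ↔ ¬ A v u)) {u v w : V} (h4 : ¬ ReachLE A 4 v u)
    (huv : ReachLE A 2 u v) (hvw : ReachLE A 2 v w) : ReachLE A 2 u w := by
  have back : ∀ {w}, f w ≠ f u → ReachLE A 2 v w → A u w := fun {w} hw hvw =>
    (hA u w hw.symm).2 fun hwu => h4 ((hvw.step hwu).mono (by omega))
  by_cases hw : f w = f u
  · rcases hvw with rfl | ⟨z, hvz, hzw⟩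
    · exact huv
    · have hz : f z ≠ f u := fun h => hf _ _ (h.trans hw.symm) hzw
      exact (ReachLE.of_arc (back hz (ReachLE.mono one_le_two hvz))).step hzw
  · exact (ReachLE.of_arc (back hw hvw)).mono (by omega)

end Multipartite

/-- Every `H`-colored `r`-partite tournament (`r ≥ 2`) has a `(k,H)`-kernel for every
`k ≥ 5`. -/
theorem rPartiteTournament_has_kHKernel [Fintype V]
    (A : V → V → Prop) (hloopless : ∀ v : V, ¬ A v v)
    (r : ℕ) (hr : 2 ≤ r) (hpart : RPartiteTournament A r)
    (AH : VH → VH → Prop) (ρ : V → V → VH)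
    (k : ℕ) (hk : 5 ≤ k) :
    ∃ S : Set V, IsKHKernel A AH ρ k S := by
  obtain ⟨f, -, hf, hA⟩ := hpart
  have reach : ∀ {u v}, u ≠ v → ReachLE A 4 u v → ClosureAdj A AH ρ (k - 1) u v := by
    intro u v huv h
    obtain ⟨m, hm, x, hx, hx0, hxm⟩ := h.exists_isPath
    refine ⟨m, x, Nat.one_le_iff_ne_zero.mpr fun h0 => huv ?_, hx, hx0, hxm,
      HLenOpen_le (by omega) (by omega)⟩
    rw [← hx0, ← hxm, h0]
  obtain ⟨S, hind, habs⟩ := exists_isKernel_of_potential (ClosureAdj A AH ρ (k - 1))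
    (fun u => (Finset.univ.filter (ReachLE A 2 u)).card) <| by
      rintro u v ⟨n, x, hn, hx, hx0, hxn, -⟩ hvu
      have hne : v ≠ u := by
        rintro rfl
        have := hx.2 0 (by omega) n le_rfl (hx0.trans hxn.symm)
        omega
      have h4 : ¬ ReachLE A 4 v u := fun h => hvu (reach hne h)
      have h2 := reachLE_two_of_walk hf hA h4 hx.1 hx0 hxn
      refine Finset.card_lt_card (Finset.ssubset_iff_of_subset ?_ |>.mpr ⟨u, ?_, ?_⟩)
      · intro w hw
        simp only [Finset.mem_filter, Finset.mem_univ, true_and] at hw ⊢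
        exact reachLE_two_subset hf hA h4 h2 hw
      · simpa using ReachLE.refl A 2 u
      · simpa using fun h => h4 (ReachLE.mono (by omega) h)
  refine ⟨S, fun u hu v hv huv n x hx hx0 hxn => ?_, fun v hv => ?_⟩
  · by_contra hlt
    refine hind u hu v hv huv ⟨n, x, Nat.one_le_iff_ne_zero.mpr fun h0 => huv ?_, hx, hx0, hxn,
      by omega⟩
    rw [← hx0, ← hxn, h0]
  · obtain ⟨w, hw, n, x, -, hx⟩ := habs v hv
    exact ⟨w, hw, n, x, hx⟩
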